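/- Let x = P(x) be a minPPS in SNF with least fixed point q* satisfying 0 < q* < 1. For any x ∈ ℝ^n with 0 ≤ x ≤ q* and any λ > 0, letting I(x) denote the unique fixed point of the linearized system z = P^x(z) (which exists), we have I(x) ≤ q*, and furthermore if q* − x ≤ λ(1 − q*) then q* − I(x) ≤ (λ/2)(1 − q*). -/

import Mathlib

open Matrix Finset

namespace PPS

/-- One equation of a max/min PPS in simple normal form (SNF):
form L (linear), form Q (product of two variables), or form M
(max or min of two variables, according to the kind of the system). -/
inductive Eqn (n : ℕ) where
  | lin (a0 : ℝ) (a : Fin n → ℝ) : Eqn n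
  | quad (j k : Fin n) : Eqn n
  | m (j k : Fin n) : Eqn n

namespace Eqn

/-- Validity of the coefficients of a form-L equation: all coefficients,
including the constant term, are nonnegative and sum to at most 1. -/
def Valid {n : ℕ} : Eqn n → Prop
  | .lin a0 a => 0 ≤ a0 ∧ (∀ j, 0 ≤ a j) ∧ a0 + ∑ j, a j ≤ 1
  | _ => True

/-- Evaluate one equation; `isMax` says whether form-M equations are max or min. -/
def eval {n : ℕ} (isMax : Bool) : Eqn n → (Fin n → ℝ) → ℝ
  | .lin a0 a, x => a0 + ∑ j, a j * x j
  | .quad j k, x => x j * x k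
  | .m j k, x => if isMax then max (x j) (x k) else min (x j) (x k)

/-- An equation of form L or Q (no max/min). -/
def IsLinOrQuad {n : ℕ} : Eqn n → Prop
  | .m _ _ => False
  | _ => True

/-- Row of the Jacobian matrix of one (form L or Q) equation at the point `y`. -/
def jacRow {n : ℕ} : Eqn n → (Fin n → ℝ) → (Fin n → ℝ)
  | .lin _ a, _ => a
  | .quad j k, y => fun l => (if l = j then y k else 0) + (if l = k then y j else 0)
  | .m _ _, _ => fun _ => 0

end Eqn

/-- A system of `n` equations in `n` variables, in SNF. -/
abbrev Sys (n : ℕ) : Type := Fin n → Eqn n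

/-- All equations have valid (probabilistic) coefficients. -/
def SysValid {n : ℕ} (S : Sys n) : Prop := ∀ i, (S i).Valid

/-- A PPS: a system with no form-M equations. -/
def IsPPS {n : ℕ} (S : Sys n) : Prop := ∀ i, (S i).IsLinOrQuad

/-- The map `P : ℝ^n → ℝ^n` of the system. -/
def eval {n : ℕ} (isMax : Bool) (S : Sys n) (x : Fin n → ℝ) : Fin n → ℝ :=
  fun i => (S i).eval isMax x

/-- The Jacobian matrix `P'(y)`. -/
def jac {n : ℕ} (S : Sys n) (y : Fin n → ℝ) : Matrix (Fin n) (Fin n) ℝ :=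
  Matrix.of fun i l => (S i).jacRow y l

/-- `q` is the least fixed point of `x = P(x)` in `[0,1]^n`. -/
def IsLFP {n : ℕ} (isMax : Bool) (S : Sys n) (q : Fin n → ℝ) : Prop :=
  eval isMax S q = q ∧ (∀ i, 0 ≤ q i) ∧ (∀ i, q i ≤ 1) ∧
    (∀ q' : Fin n → ℝ, eval isMax S q' = q' → (∀ i, 0 ≤ q' i) → (∀ i, q' i ≤ 1) →
      ∀ i, q i ≤ q' i)

/-- Applying a policy `σ` (a choice, for each form-M equation `max/min {x_j, x_k}`,
of one of the two variables: `true` picks `x_j`, `false` picks `x_k`) to the system,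
yielding the PPS `x = P_σ(x)`. -/
def applyPolicy {n : ℕ} (S : Sys n) (σ : Fin n → Bool) : Sys n := fun i =>
  match S i with
  | .m j k => .lin 0 (fun l => if l = (if σ i then j else k) then 1 else 0)
  | e => e

/-- The linearization `P^y` of `P` at `y`: equations of form L and M are unchanged,
and a form-Q equation `x_j x_k` becomes `y_j x_k + x_j y_k - y_j y_k`. -/
def linEval {n : ℕ} (isMax : Bool) (S : Sys n) (y x : Fin n → ℝ) : Fin n → ℝ := fun i =>
  match S i with
  | .quad j k => y j * x k + x j * y k - y j * y k
  | e => e.eval isMax x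

/-- The Newton operator `N(y) = y + (I - P'(y))⁻¹ (P(y) - y)`. -/
noncomputable def newton {n : ℕ} (isMax : Bool) (S : Sys n) (y : Fin n → ℝ) : Fin n → ℝ :=
  y + (1 - jac S y)⁻¹ *ᵥ (eval isMax S y - y)

/-- the l∞ norm of a vector -/
noncomputable def vnorm {n : ℕ} (v : Fin n → ℝ) : ℝ := ⨆ i, |v i|

/-- the l∞ (max absolute row sum) norm of a matrix -/
noncomputable def mnorm {n : ℕ} (A : Matrix (Fin n) (Fin n) ℝ) : ℝ := ⨆ i, ∑ j, |A i j|

end PPS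

namespace PPS

/-- Knaster–Tarski on an order interval of `ι → ℝ`. -/
theorem exists_fixedPoint_mem_Icc {ι : Type*} {f : (ι → ℝ) → ι → ℝ} {a b : ι → ℝ}
    (hab : a ≤ b) (hf : MonotoneOn f (Set.Icc a b)) (ha : a ≤ f a) (hb : f b ≤ b) :
    ∃ z ∈ Set.Icc a b, f z = z := by
  have : Fact (a ≤ b) := ⟨hab⟩
  let g : Set.Icc a b →o Set.Icc a b :=
    { toFun := fun w => ⟨f w, ha.trans (hf ⟨le_rfl, hab⟩ w.2 w.2.1),
        (hf w.2 ⟨hab, le_rfl⟩ w.2.2).trans hb⟩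
      monotone' := fun u w huw => hf u.2 w.2 huw }
  exact ⟨g.lfp, g.lfp.2, congrArg Subtype.val g.map_lfp⟩

variable {n : ℕ} {S : Sys n} {q x w y z : Fin n → ℝ}

theorem Eqn.eval_mono {e : Eqn n} (he : e.Valid) (hx : 0 ≤ x) (hxy : x ≤ y) :
    e.eval false x ≤ e.eval false y := by
  cases e with
  | lin a0 a =>
    exact add_le_add_right
      (sum_le_sum fun j _ => mul_le_mul_of_nonneg_left (hxy j) (he.2.1 j)) _
  | quad j k => exact mul_le_mul (hxy j) (hxy k) (hx k) ((hx j).trans (hxy j))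
  | m j k => exact min_le_min (hxy j) (hxy k)

/-- A nonnegative prefixed point in the unit cube bounds the least fixed point. -/
theorem IsLFP.le_of_eval_le (hval : SysValid S) (hq : IsLFP false S q)
    (hy0 : 0 ≤ y) (hy1 : y ≤ 1) (hy : eval false S y ≤ y) : q ≤ y := by
  have h0 : 0 ≤ eval false S 0 := by
    intro i
    have hv := hval i
    unfold eval
    generalize S i = e at hv ⊢
    rcases e with ⟨a0, a⟩ | ⟨j, k⟩ | ⟨j, k⟩
    · simpa [Eqn.eval] using hv.1
    · simp [Eqn.eval]
    · simp [Eqn.eval]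
  obtain ⟨z, hz, hfz⟩ := exists_fixedPoint_mem_Icc hy0
    (f := eval false S)
    (fun u hu v _ huv i => Eqn.eval_mono (hval i) hu.1 huv) h0 hy
  exact fun i => (hq.2.2.2 z hfz hz.1 (fun j => (hz.2 j).trans (hy1 j)) i).trans (hz.2 i)

/-- The sublinear map bounding the increments of the linearization at `x`. -/
def linIncr (S : Sys n) (x w : Fin n → ℝ) : Fin n → ℝ := fun i =>
  match S i with
  | .lin _ a => ∑ j, a j * w j
  | .quad j k => x j * w k + w j * x k
  | .m j k => max (w j) (w k)

theorem linEval_sub_le (S : Sys n) (x y z : Fin n → ℝ) :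
    linEval false S x y - linEval false S x z ≤ linIncr S x (y - z) := by
  intro i
  simp only [Pi.sub_apply, linEval, linIncr]
  rcases S i with ⟨a0, a⟩ | ⟨j, k⟩ | ⟨j, k⟩
  · simp [Eqn.eval, mul_sub]
  · linarith
  · simp only [Eqn.eval, Bool.false_eq_true, if_false]
    grind

theorem linEval_mono (hval : SysValid S) (hx : 0 ≤ x) : Monotone (linEval false S x) := by
  intro y z hyz i
  have hv := hval i
  simp only [linEval]
  generalize S i = e at hv ⊢
  rcases e with ⟨a0, a⟩ | ⟨j, k⟩ | ⟨j, k⟩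
  · exact add_le_add_right
      (sum_le_sum fun j _ => mul_le_mul_of_nonneg_left (hyz j) (hv.2.1 j)) _
  · have := mul_le_mul_of_nonneg_left (hyz k) (hx j)
    have := mul_le_mul_of_nonneg_right (hyz j) (hx k)
    linarith
  · exact min_le_min (hyz j) (hyz k)

/-- No nonempty set of variables can be trapped, i.e. be such that each of its equations is linear
without constant term and supported on the set, or a minimum with an argument in the set:
otherwise the least fixed point would vanish there. -/
theorem IsLFP.not_trapped (hval : SysValid S) (hq : IsLFP false S q) (h0 : ∀ i, 0 < q i)
    (A : Set (Fin n)) (hA : ∀ i ∈ A, match S i with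
      | .lin a0 a => a0 = 0 ∧ ∀ j, a j ≠ 0 → j ∈ A
      | .quad _ _ => False
      | .m j k => j ∈ A ∨ k ∈ A) : A = ∅ := by
  classical
  by_contra hne
  obtain ⟨i, hi⟩ := Set.nonempty_iff_ne_empty.2 hne
  let y : Fin n → ℝ := fun i => if i ∈ A then 0 else q i
  have hy0 : 0 ≤ y := fun i => by
    by_cases h : i ∈ A <;> simp [y, h, (h0 i).le]
  have hyq : y ≤ q := fun i => by
    by_cases h : i ∈ A <;> simp [y, h, (h0 i).le]
  have hyA : ∀ i ∈ A, y i = 0 := fun i h => by simp [y, h]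
  have hle : q ≤ y := by
    refine hq.le_of_eval_le hval hy0 (hyq.trans hq.2.2.1) fun i => ?_
    by_cases h : i ∈ A
    · rw [hyA i h]
      have hi := hA i h
      unfold eval
      generalize S i = e at hi ⊢
      rcases e with ⟨a0, a⟩ | ⟨j, k⟩ | ⟨j, k⟩
      · simp only [Eqn.eval, hi.1, zero_add]
        refine (sum_eq_zero fun j _ => ?_).le
        by_cases haj : a j = 0
        · rw [haj, zero_mul]
        · rw [hyA j (hi.2 j haj), mul_zero]
      · exact hi.elim
      · rcases hi with hi | hi
        · exact (min_le_left _ _).trans_eq (hyA j hi)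
        · exact (min_le_right _ _).trans_eq (hyA k hi)
    · have hi : y i = q i := by simp [y, h]
      rw [hi]
      exact (Eqn.eval_mono (hval i) hy0 hyq).trans_eq (congrFun hq.1 i)
  exact absurd (hle i) (by rw [hyA i hi]; exact not_le.2 (h0 i))

/-- Termwise equality in a tight weighted sum. -/
theorem eq_of_sum_mul_le {ι : Type*} [Fintype ι] {a u v : ι → ℝ} (ha : ∀ j, 0 ≤ a j)
    (huv : u ≤ v) (h : ∑ j, a j * v j ≤ ∑ j, a j * u j) (j : ι) (hj : a j ≠ 0) : u j = v j := by
  have hle : ∀ j ∈ univ, a j * u j ≤ a j * v j :=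
    fun j _ => mul_le_mul_of_nonneg_left (huv j) (ha j)
  exact mul_left_cancel₀ hj
    ((sum_eq_sum_iff_of_le hle).1 (le_antisymm (sum_le_sum hle) h) j (mem_univ j))

/-- Maximum principle for the linearization at a point below the least fixed point. -/
theorem nonpos_of_le_linIncr (hval : SysValid S) (hq : IsLFP false S q) (h0 : ∀ i, 0 < q i)
    (h1 : ∀ i, q i < 1) (hx0 : 0 ≤ x) (hxq : x ≤ q) (hw : w ≤ linIncr S x w) : w ≤ 0 := by
  intro i0
  by_contra! hi0
  have hv : ∀ i, 0 < 1 - q i := fun i => sub_pos.2 (h1 i)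
  obtain ⟨m, -, hm⟩ := exists_max_image univ (fun i => w i / (1 - q i)) ⟨i0, mem_univ _⟩
  obtain ⟨t, ht⟩ : ∃ t, t = w m / (1 - q m) := ⟨_, rfl⟩
  simp only [← ht] at hm
  have htpos : 0 < t := (div_pos hi0 (hv i0)).trans_le (hm i0 (mem_univ _))
  have hwt : ∀ i, w i ≤ t * (1 - q i) := fun i => (div_le_iff₀ (hv i)).1 (hm i (mem_univ _))
  let A : Finset (Fin n) := univ.filter fun i => w i = t * (1 - q i)
  have hmA : m ∈ A := by
    simp only [A, mem_filter, mem_univ, true_and]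
    rw [ht, div_mul_cancel₀ _ (hv m).ne']
  obtain ⟨p, hpA, hp⟩ := exists_min_image A q ⟨m, hmA⟩
  have key : {i | i ∈ A ∧ q i = q p} = ∅ := by
    refine hq.not_trapped hval h0 _ fun i hi => ?_
    obtain ⟨hiA, hip⟩ := hi
    have hwi : w i = t * (1 - q i) := by simpa [A] using hiA
    have hvi := hval i
    have hqi : (S i).eval false q = q i := congrFun hq.1 i
    have hHi := hw i
    simp only [linIncr] at hHi
    have memA : ∀ j, w j = t * (1 - q j) → j ∈ A := fun j h => by simpa [A] using h
    generalize S i = e at hvi hqi hHi ⊢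
    rcases e with ⟨a0, a⟩ | ⟨j, k⟩ | ⟨j, k⟩
    · obtain ⟨ha0, ha, hsum⟩ := hvi
      simp only [Eqn.eval] at hqi
      have hs : ∑ j, a j * (t * (1 - q j)) = t * (∑ j, a j - ∑ j, a j * q j) := by
        rw [← sum_sub_distrib, mul_sum]
        exact sum_congr rfl fun j _ => by ring
      have hsA : ∀ j, a j ≠ 0 → j ∈ A := by
        refine fun j hj => memA j (eq_of_sum_mul_le ha hwt ?_ j hj)
        rw [hs]
        refine le_trans ?_ (hwi.symm.le.trans hHi)
        exact mul_le_mul_of_nonneg_left (by linarith) htpos.le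
      have hsp : (∑ j, a j) * q p ≤ ∑ j, a j * q j := by
        rw [sum_mul]
        refine sum_le_sum fun j _ => ?_
        by_cases hj : a j = 0
        · simp [hj]
        · exact mul_le_mul_of_nonneg_left (hp j (hsA j hj)) (ha j)
      have htight : 1 ≤ a0 + ∑ j, a j := by
        have h2 : t * (1 - q i) ≤ t * (∑ j, a j - ∑ j, a j * q j) := by
          rw [← hs, ← hwi]
          exact hHi.trans (sum_le_sum fun j _ => mul_le_mul_of_nonneg_left (hwt j) (ha j))
        have := le_of_mul_le_mul_left h2 htpos
        linarith
      have ha00 : a0 = 0 := by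
        have := hv p
        nlinarith
      have hqp : ∑ j, a j * (if a j = 0 then q p else q j) ≤ ∑ j, a j * q p := by
        have h : ∀ j, a j * (if a j = 0 then q p else q j) = a j * q j := fun j => by
          split_ifs with h <;> simp [h]
        have hone : ∑ j, a j = 1 := by linarith
        simp only [h, ← sum_mul, hone]
        linarith
      refine ⟨ha00, fun j hj => ⟨hsA j hj, ?_⟩⟩
      have h := eq_of_sum_mul_le ha (fun l => ?_) hqp j hj
      · simpa [hj] using h.symm
      · dsimp only
        split_ifs with hl
        · exact le_rfl
        · exact hp l (hsA l hl)
    · simp only [Eqn.eval] at hqi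
      have hj := hwt j
      have hk := hwt k
      have e1 : x j * w k ≤ q j * (t * (1 - q k)) :=
        (mul_le_mul_of_nonneg_left hk (hx0 j)).trans
          (mul_le_mul_of_nonneg_right (hxq j) (mul_pos htpos (hv k)).le)
      have e2 : w j * x k ≤ (t * (1 - q j)) * q k :=
        (mul_le_mul_of_nonneg_right hj (hx0 k)).trans
          (mul_le_mul_of_nonneg_left (hxq k) (mul_pos htpos (hv j)).le)
      have e3 : 0 < t * ((1 - q j) * (1 - q k)) := mul_pos htpos (mul_pos (hv j) (hv k))
      dsimp only at hHi ⊢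
      rw [hwi, ← hqi] at hHi
      linarith
    · simp only [Eqn.eval, Bool.false_eq_true, if_false] at hqi
      have choice : ∀ l, q i ≤ q l → w i ≤ w l → l ∈ A ∧ q l = q p := by
        intro l hl hwl
        have hlt : t * (1 - q i) ≤ t * (1 - q l) := hwi ▸ hwl.trans (hwt l)
        have hli : q l = q i := by
          have := le_of_mul_le_mul_left hlt htpos
          linarith
        exact ⟨memA l (le_antisymm (hwt l) (by rw [hli, ← hwi]; exact hwl)), hli.trans hip⟩
      rcases le_max_iff.1 hHi with h | h
      · exact Or.inl (choice j (hqi ▸ min_le_left _ _) h)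
      · exact Or.inr (choice k (hqi ▸ min_le_right _ _) h)
  exact (Set.eq_empty_iff_forall_notMem.1 key p) ⟨hpA, rfl⟩

/-- Comparison principle for the linearization at a point below the least fixed point. -/
theorem le_of_le_linEval_of_linEval_le (hval : SysValid S) (hq : IsLFP false S q)
    (h0 : ∀ i, 0 < q i) (h1 : ∀ i, q i < 1) (hx0 : 0 ≤ x) (hxq : x ≤ q)
    (hy : y ≤ linEval false S x y) (hz : linEval false S x z ≤ z) : y ≤ z :=
  sub_nonpos.1 (nonpos_of_le_linIncr hval hq h0 h1 hx0 hxq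
    ((sub_le_sub hy hz).trans (linEval_sub_le S x y z)))

theorem linEval_le_eval (S : Sys n) (hxy : x ≤ y) : linEval false S x y ≤ eval false S y := by
  intro i
  simp only [linEval, eval]
  rcases S i with ⟨a0, a⟩ | ⟨j, k⟩ | ⟨j, k⟩
  · exact le_rfl
  · simp only [Eqn.eval]
    nlinarith [mul_nonneg (sub_nonneg.2 (hxy j)) (sub_nonneg.2 (hxy k))]
  · exact le_rfl

theorem le_linEval_of_sub_le (hval : SysValid S) (hq : eval false S q = q) (h1 : q ≤ 1)
    (hxq : x ≤ q) {c : ℝ} (hc : 0 ≤ c) (hd : ∀ i, q i - x i ≤ 2 * c * (1 - q i)) :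
    (fun i => q i - c * (1 - q i)) ≤ linEval false S x fun i => q i - c * (1 - q i) := by
  intro i
  have hv := hval i
  have hqi : (S i).eval false q = q i := congrFun hq i
  simp only [linEval]
  generalize S i = e at hv hqi ⊢
  rcases e with ⟨a0, a⟩ | ⟨j, k⟩ | ⟨j, k⟩
  · obtain ⟨-, -, hsum⟩ := hv
    simp only [Eqn.eval] at hqi ⊢
    have hs : ∑ j, a j * (q j - c * (1 - q j)) =
        ∑ j, a j * q j - c * (∑ j, a j - ∑ j, a j * q j) := by
      rw [← sum_sub_distrib, mul_sum, ← sum_sub_distrib]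
      exact sum_congr rfl fun j _ => by ring
    rw [hs]
    nlinarith
  · simp only [Eqn.eval] at hqi ⊢
    have hdj := mul_le_mul_of_nonneg_right (hd j) (sub_nonneg.2 (hxq k))
    have hdk := mul_le_mul_of_nonneg_right (hd k) (sub_nonneg.2 (hxq j))
    have hvv := mul_nonneg hc (mul_nonneg (sub_nonneg.2 (h1 j)) (sub_nonneg.2 (h1 k)))
    simp only [Pi.one_apply] at hvv
    rw [← hqi]
    linarith
  · simp only [Eqn.eval, Bool.false_eq_true, if_false] at hqi ⊢
    have hj : q i ≤ q j := hqi ▸ min_le_left _ _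
    have hk : q i ≤ q k := hqi ▸ min_le_right _ _
    exact le_min (by nlinarith) (by nlinarith)

end PPS

open PPS in
/-- Let `x = P(x)` be a minPPS in SNF with LFP `0 < q* < 1`.  For any `0 ≤ x ≤ q*` and
`λ > 0`: the linearized system `z = P^x(z)` has a unique fixed point, and letting
`I(x)` denote it, `I(x) ≤ q*`, and if `q* - x ≤ λ(1 - q*)`
then `q* - I(x) ≤ (λ/2)(1 - q*)`. -/
theorem stmt12 {n : ℕ} (S : Sys n) (hval : SysValid S)
    (q : Fin n → ℝ) (hq : IsLFP false S q) (h0 : ∀ i, 0 < q i) (h1 : ∀ i, q i < 1)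
    (x : Fin n → ℝ) (hx0 : ∀ i, 0 ≤ x i) (hxq : ∀ i, x i ≤ q i)
    (lam : ℝ) (hlam : 0 < lam) :
    (∃! z : Fin n → ℝ, linEval false S x z = z) ∧
    (∀ Ix : Fin n → ℝ, linEval false S x Ix = Ix →
      (∀ i, Ix i ≤ q i) ∧
      ((∀ i, q i - x i ≤ lam * (1 - q i)) →
        ∀ i, q i - Ix i ≤ (lam / 2) * (1 - q i))) := by
  have hxq' : x ≤ q := hxq
  have hGq : linEval false S x q ≤ q := (linEval_le_eval S hxq').trans_eq hq.1
  have comparison {y z : Fin n → ℝ} (hy : y ≤ linEval false S x y)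
      (hz : linEval false S x z ≤ z) : y ≤ z :=
    le_of_le_linEval_of_linEval_le hval hq h0 h1 hx0 hxq' hy hz
  have lower {c : ℝ} (hc : 0 ≤ c) (hd : ∀ i, q i - x i ≤ 2 * c * (1 - q i)) :=
    le_linEval_of_sub_le hval hq.1 hq.2.2.1 hxq' hc hd
  refine ⟨?_, fun z hz => ⟨comparison hz.ge hGq, fun hd i => ?_⟩⟩
  · have hnonneg : ∀ i, 0 ≤ (q i - x i) / (1 - q i) := fun i =>
      div_nonneg (sub_nonneg.2 (hxq i)) (sub_pos.2 (h1 i)).le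
    obtain ⟨c, hc, hd⟩ : ∃ c : ℝ, 0 ≤ c ∧ ∀ i, q i - x i ≤ 2 * c * (1 - q i) := by
      refine ⟨(∑ i, (q i - x i) / (1 - q i)) / 2,
        div_nonneg (sum_nonneg fun i _ => hnonneg i) two_pos.le, fun i => ?_⟩
      rw [mul_div_cancel₀ _ two_ne_zero, ← div_le_iff₀ (sub_pos.2 (h1 i))]
      exact single_le_sum (fun j _ => hnonneg j) (mem_univ i)
    obtain ⟨z, -, hz⟩ := exists_fixedPoint_mem_Icc
      (fun i => sub_le_self _ (mul_nonneg hc (sub_pos.2 (h1 i)).le))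
      ((linEval_mono hval hx0).monotoneOn _) (lower hc hd) hGq
    exact ⟨z, hz, fun y hy => le_antisymm (comparison hy.ge hz.le) (comparison hz.ge hy.le)⟩
  · have := comparison (lower (half_pos hlam).le fun i => by
      rw [mul_div_cancel₀ _ two_ne_zero]; exact hd i) hz.le i
    dsimp only at this
    linarith
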